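/- arXiv:1210.7985 — 6 statements merged into one kernel-verified Lean document; each statement's English description precedes it below -/
import Mathlib

section
/- Let (G, t₁, t₂) be a Shannon position. A non-terminal vertex v of G is dead if and only if every edge of G incident to v is dead. -/
open SimpleGraph

variable {V : Type*}

/-- Short wins the complete colouring `c` in graph `H` (with terminals `t₁, t₂`)
iff there is a walk from `t₁` to `t₂` all of whose internal vertices are black (`true`). -/
def ShortWins (H : SimpleGraph V) (t₁ t₂ : V) (c : V → Bool) : Prop :=
  ∃ p : H.Walk t₁ t₂, ∀ x ∈ p.support, x ≠ t₁ → x ≠ t₂ → c x = true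

/-- A vertex `v` is dead if, for every complete colouring, changing the colour of `v`
does not change whether Short wins. -/
def DeadVertex [DecidableEq V] (G : SimpleGraph V) (t₁ t₂ : V) (v : V) : Prop :=
  ∀ c : V → Bool, (ShortWins G t₁ t₂ c ↔ ShortWins G t₁ t₂ (Function.update c v (! c v)))

/-- An edge `e` is dead if, for every complete colouring, Short wins in `G`
iff Short wins in `G − e`. -/
def DeadEdge (G : SimpleGraph V) (t₁ t₂ : V) (e : Sym2 V) : Prop :=
  ∀ c : V → Bool, (ShortWins G t₁ t₂ c ↔ ShortWins (G.deleteEdges {e}) t₁ t₂ c)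

/-- The neighbourhood `Γ(S)` of a vertex set: vertices outside `S` adjacent to a member of `S`. -/
def nbhd (G : SimpleGraph V) (S : Set V) : Set V := {v | v ∉ S ∧ ∃ u ∈ S, G.Adj u v}

theorem ShortWins.mono {G H : SimpleGraph V} {t₁ t₂ : V} {c d : V → Bool}
    (hGH : G ≤ H) (hcd : ∀ x, c x = true → d x = true) (h : ShortWins G t₁ t₂ c) :
    ShortWins H t₁ t₂ d := by
  obtain ⟨p, hp⟩ := h
  refine ⟨p.mapLe hGH, fun x hx h₁ h₂ => hcd x (hp x ?_ h₁ h₂)⟩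
  simpa using hx

/-- The subgraph formed by the edges of `G` with both endpoints satisfying `P`. -/
def edgesWithin (G : SimpleGraph V) (P : V → Prop) : SimpleGraph V where
  Adj x y := G.Adj x y ∧ P x ∧ P y
  symm := ⟨fun _ _ h => ⟨h.1.symm, h.2.2, h.2.1⟩⟩
  loopless := ⟨fun _ h => G.irrefl h.1⟩

theorem edgesWithin_le (G : SimpleGraph V) (P : V → Prop) : edgesWithin G P ≤ G :=
  fun _ _ h => h.1

theorem edgesWithin_forall_mem_support {G : SimpleGraph V} {P : V → Prop} {a b : V}
    (p : (edgesWithin G P).Walk a b) (ha : P a) : ∀ x ∈ p.support, P x := by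
  induction p with
  | nil => simpa using ha
  | cons h p ih =>
    intro x hx
    rw [Walk.support_cons, List.mem_cons] at hx
    rcases hx with rfl | hx
    · exact ha
    · exact ih h.2.2 x hx

theorem reachable_edgesWithin {G : SimpleGraph V} {P : V → Prop} {a b : V}
    (p : G.Walk a b) (hp : ∀ x ∈ p.support, P x) : (edgesWithin G P).Reachable a b := by
  refine ⟨p.transfer _ fun e he => ?_⟩
  induction e with
  | _ x y =>
    exact ⟨p.adj_of_mem_edges he, hp x (p.fst_mem_support_of_mem_edges he),
      hp y (p.snd_mem_support_of_mem_edges he)⟩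

theorem dist_getVert_of_length_eq_dist {G : SimpleGraph V} {a b : V} (p : G.Walk a b)
    (hp : p.length = G.dist a b) {i : ℕ} (hi : i ≤ p.length) :
    G.dist a (p.getVert i) = i := by
  have h₁ := dist_le (p.take i)
  have h₂ := dist_le (p.drop i)
  have h₃ : G.dist a b ≤ G.dist a (p.getVert i) + G.dist (p.getVert i) b := by
    obtain ⟨q, hq⟩ := (p.take i).reachable.exists_walk_length_eq_dist
    obtain ⟨r, hr⟩ := (p.drop i).reachable.exists_walk_length_eq_dist
    rw [← hq, ← hr, ← Walk.length_append]
    exact dist_le _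
  rw [Walk.take_length] at h₁
  rw [Walk.drop_length] at h₂
  omega

/-- A shortest walk avoiding white vertices is an induced path, so if it passes through `v`,
each of its edges at `v` separates the terminals once only its own vertices are black. -/
theorem ShortWins.update_false [DecidableEq V] {G : SimpleGraph V} {t₁ t₂ v : V}
    (hv₁ : v ≠ t₁) (hdead : ∀ e ∈ G.edgeSet, v ∈ e → DeadEdge G t₁ t₂ e)
    {c : V → Bool} (h : ShortWins G t₁ t₂ c) :
    ShortWins G t₁ t₂ (Function.update c v false) := by
  classical
  by_contra hlose
  obtain ⟨p₀, hp₀⟩ := h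
  set P : V → Prop := fun x => x ≠ t₁ → x ≠ t₂ → c x = true
  obtain ⟨p, hp⟩ := (reachable_edgesWithin (P := P) p₀ hp₀).exists_walk_length_eq_dist
  have hsupp := edgesWithin_forall_mem_support p (fun h => absurd rfl h)
  have hv : v ∈ p.support := by
    by_contra hv
    refine hlose ⟨p.mapLe (edgesWithin_le G P), fun x hx h₁ h₂ => ?_⟩
    replace hx : x ∈ p.support := by simpa using hx
    rw [Function.update_of_ne (ne_of_mem_of_not_mem hx hv)]
    exact hsupp x hx h₁ h₂
  obtain ⟨k, hkv, hk⟩ := Walk.mem_support_iff_exists_getVert.1 hv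
  obtain _ | k := k
  · exact hv₁ (by simpa using hkv.symm)
  have hadj : (edgesWithin G P).Adj (p.getVert k) v := hkv ▸ p.adj_getVert_succ (by omega)
  have hwin : ShortWins G t₁ t₂ (fun x => decide (x ∈ p.support)) :=
    ⟨p.mapLe (edgesWithin_le G P), fun x hx _ _ => by simpa using hx⟩
  obtain ⟨q, hq⟩ := (hdead s(p.getVert k, v) hadj.1 (Sym2.mem_mk_right _ _) _).1 hwin
  have hqp : ∀ x ∈ q.support, x ∈ p.support := by
    intro x hx
    by_cases h₁ : x = t₁
    · simp [h₁]
    by_cases h₂ : x = t₂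
    · simp [h₂]
    simpa using hq x hx h₁ h₂
  obtain ⟨d, hd, hdk, hdk'⟩ := q.exists_boundary_dart
    {x | (edgesWithin G P).dist t₁ x < k + 1} (by simp) (by simp [← hp]; omega)
  have hx := hqp _ (q.dart_fst_mem_support_of_mem_darts hd)
  have hy := hqp _ (q.dart_snd_mem_support_of_mem_darts hd)
  have hG := d.adj
  rw [deleteEdges_adj] at hG
  have hxy : (edgesWithin G P).Adj d.fst d.snd := ⟨hG.1, hsupp _ hx, hsupp _ hy⟩
  obtain ⟨i, hix, hi⟩ := Walk.mem_support_iff_exists_getVert.1 hx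
  obtain ⟨j, hjy, hj⟩ := Walk.mem_support_iff_exists_getVert.1 hy
  have hdi := dist_getVert_of_length_eq_dist p hp hi
  have hdj := dist_getVert_of_length_eq_dist p hp hj
  have hle : (edgesWithin G P).dist t₁ (p.getVert j) ≤ i + 1 := by
    have := dist_le ((p.take i).concat (hix.symm ▸ hjy.symm ▸ hxy))
    rw [Walk.length_concat, Walk.take_length] at this
    omega
  rw [Set.mem_ofPred_eq, ← hix] at hdk
  rw [Set.mem_ofPred_eq, ← hjy] at hdk'
  obtain rfl : i = k := by omega
  obtain rfl : j = i + 1 := by omega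
  exact hG.2 (by rw [← hix, ← hjy, hkv]; rfl)

theorem ShortWins.deleteEdges_of_update_false [DecidableEq V] {G : SimpleGraph V} {t₁ t₂ v : V}
    (hv₁ : v ≠ t₁) (hv₂ : v ≠ t₂) {e : Sym2 V} (hve : v ∈ e) {c : V → Bool}
    (h : ShortWins G t₁ t₂ (Function.update c v false)) :
    ShortWins (G.deleteEdges {e}) t₁ t₂ c := by
  obtain ⟨p, hp⟩ := h
  have hv : v ∉ p.support := fun hv => by simpa using hp v hv hv₁ hv₂
  refine ⟨p.toDeleteEdge e fun he => hv (p.mem_support_of_mem_edges he hve), fun x hx h₁ h₂ => ?_⟩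
  replace hx : x ∈ p.support := by simpa [Walk.toDeleteEdge] using hx
  have := hp x hx h₁ h₂
  rwa [Function.update_of_ne (ne_of_mem_of_not_mem hx hv)] at this

/-- A non-terminal vertex is dead iff every edge of `G` incident to it is dead. -/
theorem stmt13 [Fintype V] [DecidableEq V] (G : SimpleGraph V) (t₁ t₂ : V)
    (hne : t₁ ≠ t₂) (v : V) (hv₁ : v ≠ t₁) (hv₂ : v ≠ t₂) :
    DeadVertex G t₁ t₂ v ↔ ∀ e ∈ G.edgeSet, v ∈ e → DeadEdge G t₁ t₂ e := by
  constructor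
  · intro hdead e _ hve c
    refine ⟨fun h => ?_, ShortWins.mono (deleteEdges_le _) fun _ => id⟩
    apply ShortWins.deleteEdges_of_update_false hv₁ hv₂ hve
    cases hc : c v with
    | false => rwa [← hc, Function.update_eq_self]
    | true => simpa [hc] using (hdead c).1 h
  · intro hdead
    have key : ∀ (c : V → Bool) (b : Bool), ShortWins G t₁ t₂ c →
        ShortWins G t₁ t₂ (Function.update c v b) := by
      intro c b h
      refine (h.update_false hv₁ hdead).mono le_rfl fun x hx => ?_
      by_cases hxv : x = v
      · subst hxv
        simp at hx
      · simpa [hxv] using hx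
    refine fun c => ⟨key c _, fun h => ?_⟩
    simpa using key _ (c v) h
end

section
/- Let (G, t₁, t₂) be a Shannon position, let U be a set of vertices of G with t₁ ∉ U and t₂ ∉ U, and let w be a vertex that surrounds U, i.e. Γ(U) ⊆ Γ[w]. Then for every vertex v ∈ U adjacent to w, the edge vw is dead. -/
open SimpleGraph

variable {V : Type*}

/-- If `w` surrounds `U`, every walk to `w` starting outside `U` can be replaced by one that
avoids a given edge `s(v, w)` with `v ∈ U` and visits no vertices outside a prescribed set. -/
theorem exists_walk_deleteEdges_of_surrounds {G : SimpleGraph V} {U : Set V} {v w x : V}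
    (hv : v ∈ U) (hsurr : nbhd G U ⊆ insert w (G.neighborSet w)) (P : V → Prop)
    (p : G.Walk x w) (hx : x ∉ U) (hp : ∀ y ∈ p.support, P y) :
    ∃ q : (G.deleteEdges {s(v, w)}).Walk x w, ∀ y ∈ q.support, P y := by
  induction p with
  | nil => exact ⟨.nil, by simpa using hp⟩
  | @cons x y w h p ih =>
    have hvx : v ≠ x := fun e => hx (e ▸ hv)
    have hPx : P x := hp x (by simp)
    have hPp : ∀ z ∈ p.support, P z := fun z hz => hp z (by simp [hz])
    by_cases hy : y ∈ U
    · rcases hsurr ⟨hx, y, hy, h.symm⟩ with rfl | hwx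
      · exact ⟨.nil, by simpa using hPx⟩
      · have hxw : (G.deleteEdges {s(v, w)}).Adj x w := by
          have hwx' : G.Adj w x := hwx
          rw [deleteEdges_adj]
          refine ⟨hwx'.symm, ?_⟩
          have := hwx'.ne
          grind [Sym2.eq_iff]
        refine ⟨.cons hxw .nil, ?_⟩
        simpa using ⟨hPx, hPp w p.end_mem_support⟩
    · obtain ⟨q, hq⟩ := ih hsurr hy hPp
      have hvy : v ≠ y := fun e => hy (e ▸ hv)
      have hxy : (G.deleteEdges {s(v, w)}).Adj x y := by
        rw [deleteEdges_adj]
        refine ⟨h, ?_⟩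
        grind [Sym2.eq_iff]
      refine ⟨.cons hxy q, ?_⟩
      simpa using ⟨hPx, hq⟩

/-- If `w` surrounds a terminal-free vertex set `U` (i.e. `Γ(U) ⊆ Γ[w]`), then every
edge between `w` and a vertex of `U` is dead. -/
theorem stmt15 [Fintype V] [DecidableEq V] (G : SimpleGraph V) (t₁ t₂ : V)
    (hne : t₁ ≠ t₂) (U : Set V) (hU₁ : t₁ ∉ U) (hU₂ : t₂ ∉ U) (w : V)
    (hsurr : nbhd G U ⊆ insert w (G.neighborSet w)) :
    ∀ v ∈ U, G.Adj v w → DeadEdge G t₁ t₂ s(v, w) := by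
  intro v hv _ c
  constructor
  · rintro ⟨p, hp⟩
    by_cases hw : w ∈ p.support
    · obtain ⟨q₁, hq₁⟩ := exists_walk_deleteEdges_of_surrounds hv hsurr
        (fun x => x ≠ t₁ → x ≠ t₂ → c x = true) (p.takeUntil w hw) hU₁
        (fun x hx => hp x (p.support_takeUntil_subset_support hw hx))
      obtain ⟨q₂, hq₂⟩ := exists_walk_deleteEdges_of_surrounds hv hsurr
        (fun x => x ≠ t₁ → x ≠ t₂ → c x = true) (p.dropUntil w hw).reverse hU₂
        (fun x hx => hp x (p.support_dropUntil_subset_support hw (by simpa using hx)))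
      refine ⟨q₁.append q₂.reverse, fun x hx => ?_⟩
      rw [Walk.mem_support_append_iff, Walk.support_reverse, List.mem_reverse] at hx
      exact hx.elim (hq₁ x) (hq₂ x)
    · have he : s(v, w) ∉ p.edges := fun h => hw (p.snd_mem_support_of_mem_edges h)
      refine ⟨p.toDeleteEdge s(v, w) he, ?_⟩
      simpa [Walk.toDeleteEdge, Walk.toDeleteEdges] using hp
  · rintro ⟨p, hp⟩
    exact ⟨p.mapLe (deleteEdges_le _), by simpa using hp⟩
end

section
/- Let (G, t₁, t₂) be a Shannon position, v a non-terminal vertex, and w a vertex distinct from v. Then Γ(v) ⊆ Γ[w] holds if and only if A²(v,w) = d(v) − A(v,w), where A is the adjacency matrix of G and d(v) the degree of v; and if Γ(v) ⊆ Γ[w] and vw is an edge of G, then the edge vw is dead. -/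
open SimpleGraph

variable {V : Type*}

/-- The number of walks of length two between two vertices is their number of common
neighbours. -/
theorem SimpleGraph.adjMatrix_sq_apply_eq_card_inter [Fintype V] [DecidableEq V]
    (G : SimpleGraph V) [DecidableRel G.Adj] (v w : V) :
    (G.adjMatrix ℕ ^ 2) v w = (G.neighborFinset v ∩ G.neighborFinset w).card := by
  rw [pow_two, adjMatrix_mul_apply]
  simp only [adjMatrix_apply, Finset.sum_boole, Nat.cast_id]
  congr 1
  ext x
  simp [G.adj_comm x w]

/-- A neighbourhood inclusion `Γ(v) ⊆ Γ[w]` is detected by counting common neighbours. -/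
theorem SimpleGraph.neighborSet_subset_insert_iff [Fintype V] [DecidableEq V]
    (G : SimpleGraph V) [DecidableRel G.Adj] (v w : V) :
    G.neighborSet v ⊆ insert w (G.neighborSet w) ↔
      (G.adjMatrix ℕ ^ 2) v w = G.degree v - G.adjMatrix ℕ v w := by
  have hinter : G.neighborFinset v ∩ G.neighborFinset w =
      (G.neighborFinset v).erase w ∩ G.neighborFinset w := by
    ext x
    simp only [Finset.mem_inter, Finset.mem_erase, mem_neighborFinset]
    exact ⟨fun h => ⟨⟨h.2.ne', h.1⟩, h.2⟩, fun h => ⟨h.1.2, h.2⟩⟩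
  have hcard : G.degree v - G.adjMatrix ℕ v w = ((G.neighborFinset v).erase w).card := by
    rw [Finset.card_erase_eq_ite, card_neighborFinset_eq_degree, adjMatrix_apply]
    simp only [mem_neighborFinset]
    split_ifs <;> simp
  rw [adjMatrix_sq_apply_eq_card_inter, hinter, hcard]
  have hsub : G.neighborSet v ⊆ insert w (G.neighborSet w) ↔
      (G.neighborFinset v).erase w ⊆ G.neighborFinset w := by
    simp only [Set.subset_def, Finset.subset_iff, Finset.mem_erase, mem_neighborFinset,
      mem_neighborSet, Set.mem_insert_iff]
    exact forall_congr' fun x => by tauto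
  rw [hsub, ← Finset.inter_eq_left]
  exact ⟨fun h => by rw [h],
    fun h => Finset.eq_of_subset_of_card_le Finset.inter_subset_left h.ge⟩

/-- If `Γ(v) ⊆ Γ[w]`, then a walk to `t ≠ v` through vertices satisfying `P` can be rerouted
around the edge `vw`: from its start if that is not `v`, and otherwise from every neighbour
of `v` satisfying `P`. -/
theorem SimpleGraph.Walk.exists_walk_deleteEdges_of_neighborSet_subset {G : SimpleGraph V}
    {v w t : V} (hsub : G.neighborSet v ⊆ insert w (G.neighborSet w)) (hvt : v ≠ t)
    (P : V → Prop) {a : V} (p : G.Walk a t) (hp : ∀ x ∈ p.support, P x) :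
    (a ≠ v → ∃ q : (G.deleteEdges {s(v, w)}).Walk a t, ∀ x ∈ q.support, P x) ∧
    (a = v → ∀ u, G.Adj v u → P u →
      ∃ q : (G.deleteEdges {s(v, w)}).Walk u t, ∀ x ∈ q.support, P x) := by
  have step : ∀ {x y : V}, G.Adj x y → s(x, y) ≠ s(v, w) → P x →
      (∃ q : (G.deleteEdges {s(v, w)}).Walk y t, ∀ z ∈ q.support, P z) →
      ∃ q : (G.deleteEdges {s(v, w)}).Walk x t, ∀ z ∈ q.support, P z := by
    rintro x y hxy hne hx ⟨q, hq⟩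
    refine ⟨.cons (deleteEdges_adj.mpr ⟨hxy, hne⟩) q, fun z hz => ?_⟩
    rcases List.mem_cons.mp (Walk.support_cons _ q ▸ hz) with rfl | hz
    exacts [hx, hq z hz]
  have hw : ∀ {x : V}, G.Adj v x → x ≠ w → G.Adj w x := fun h hne =>
    (hsub h).resolve_left hne
  induction p with
  | nil => exact ⟨fun _ => ⟨.nil, by simpa using hp⟩, fun h => absurd h.symm hvt⟩
  | @cons a b _ hab p ih =>
    simp only [support_cons, List.mem_cons, forall_eq_or_imp] at hp
    obtain ⟨ha, hp⟩ := hp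
    obtain ⟨ih₁, ih₂⟩ := ih hvt hp step
    refine ⟨fun hav => ?_, ?_⟩
    · by_cases hbv : b = v
      · exact ih₂ hbv a (hbv ▸ hab.symm) ha
      · exact step hab (by simp [hav, hbv]) ha (ih₁ hbv)
    · rintro rfl u hau hu
      have hb := ih₁ hab.ne'
      by_cases hbw : b = w
      · subst hbw
        by_cases hub : u = b
        · exact hub ▸ hb
        · exact step (hw hau hub).symm (by simp [hau.ne', hub]) hu hb
      · by_cases huw : u = w
        · subst huw
          exact step (hw hab hbw) (by simp [hau.ne', hab.ne']) hu hb
        · exact step hau.symm (by simp [hau.ne', huw]) hu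
            (step hab (by simp [hbw, hab.ne']) ha hb)

/-- `Γ(v) ⊆ Γ[w]` iff `A²(v,w) = d(v) − A(v,w)`; and if `Γ(v) ⊆ Γ[w]` holds for a
non-terminal `v` and `vw` is an edge, then `vw` is dead. -/
theorem stmt16 [Fintype V] [DecidableEq V] (G : SimpleGraph V) [DecidableRel G.Adj]
    (t₁ t₂ : V) (hne : t₁ ≠ t₂) (v w : V) (hv₁ : v ≠ t₁) (hv₂ : v ≠ t₂) (hvw : v ≠ w) :
    (G.neighborSet v ⊆ insert w (G.neighborSet w) ↔
      (G.adjMatrix ℕ ^ 2) v w = G.degree v - G.adjMatrix ℕ v w) ∧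
    (G.neighborSet v ⊆ insert w (G.neighborSet w) → G.Adj v w →
      DeadEdge G t₁ t₂ s(v, w)) := by
  refine ⟨G.neighborSet_subset_insert_iff v w, fun hsub _ c => ⟨?_, ?_⟩⟩
  · rintro ⟨p, hp⟩
    exact (p.exists_walk_deleteEdges_of_neighborSet_subset hsub hv₂
      (fun x => x ≠ t₁ → x ≠ t₂ → c x = true) hp).1 hv₁.symm
  · rintro ⟨p, hp⟩
    exact ⟨p.mapLe (deleteEdges_le _), by simpa using hp⟩
end

section
/- Let (G, t₁, t₂) be a Shannon position, let v be a vertex such that the closed neighbourhood Γ[v] contains neither terminal, and let w be a vertex with A³(v,w) = Σ_{i ≠ w} A²(v,i), where A is the adjacency matrix of G and the sum runs over all vertices i other than w. Then every edge of G joining w to a vertex of Γ[v] is dead. -/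
open SimpleGraph

variable {V : Type*}

/-- The walk-counting identity forces every end `b ≠ w` of a `2`-walk from `v` to be
adjacent to `w`. -/
theorem eq_or_adj_of_adjMatrix_pow_three_eq [Fintype V] [DecidableEq V] (G : SimpleGraph V)
    [DecidableRel G.Adj] {v w : V}
    (h : (G.adjMatrix ℕ ^ 3) v w = ∑ i ∈ Finset.univ.erase w, (G.adjMatrix ℕ ^ 2) v i)
    {a b : V} (hva : G.Adj v a) (hab : G.Adj a b) : b = w ∨ G.Adj w b := by
  by_contra! hb
  have hpos : 0 < (G.adjMatrix ℕ ^ 2) v b := by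
    rw [pow_two, Matrix.mul_apply]
    refine Finset.sum_pos' (fun _ _ => Nat.zero_le _) ⟨a, Finset.mem_univ a, ?_⟩
    simp [adjMatrix_apply, hva, hab]
  rw [pow_succ, Matrix.mul_apply, ← Finset.add_sum_erase _ _ (Finset.mem_univ w)] at h
  have hlt : ∑ i ∈ Finset.univ.erase w, (G.adjMatrix ℕ ^ 2) v i * G.adjMatrix ℕ i w <
      ∑ i ∈ Finset.univ.erase w, (G.adjMatrix ℕ ^ 2) v i := by
    refine Finset.sum_lt_sum (fun i _ => ?_) ⟨b, by simp [hb.1], ?_⟩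
    · rw [adjMatrix_apply]
      split_ifs <;> simp
    · simpa [adjMatrix_apply, G.adj_comm b w, hb.2] using hpos
  simp only [adjMatrix_apply, SimpleGraph.irrefl, if_false, mul_zero, zero_add] at h hlt
  omega

/-- If `w` dominates every vertex at the end of a `2`-walk from `v`, then a walk which leaves `w`
along an edge to `Γ[v]` and ends outside `Γ[v]` can be shortened. -/
theorem exists_shorter_walk_of_mem_darts (G : SimpleGraph V) {v w u : V}
    (key : ∀ a b, G.Adj v a → G.Adj a b → b = w ∨ G.Adj w b)
    (hu : u ∈ insert v (G.neighborSet v)) {s t : V} (ht : t ∉ insert v (G.neighborSet v))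
    (q : G.Walk s t) (hq : ∃ d ∈ q.darts, d.fst = w ∧ d.snd = u) :
    ∃ q' : G.Walk s t, q'.length < q.length ∧ q'.support ⊆ q.support := by
  have shortcut : ∀ {z t : V} (r : G.Walk z t), z = w ∨ G.Adj w z →
      ∃ q' : G.Walk w t, q'.length ≤ r.length + 1 ∧ q'.support ⊆ w :: r.support := by
    rintro z t r (rfl | hz)
    · exact ⟨r, Nat.le_succ _, List.subset_cons_self _ _⟩
    · exact ⟨.cons hz r, by simp, by simp⟩
  induction q with
  | nil => simp at hq
  | @cons a b t hab r ih =>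
    obtain ⟨d, hd, rfl, rfl⟩ := hq
    rw [Walk.darts_cons, List.mem_cons] at hd
    rcases hd with rfl | hd
    · cases r with
      | nil => exact absurd hu ht
      | @cons _ y _ hby r =>
        rcases hu with hu | hu
        · have hvy : G.Adj v y := by rw [← hu]; exact hby
          cases r with
          | nil => exact absurd (Set.mem_insert_of_mem _ hvy) ht
          | cons hyz r =>
            obtain ⟨q', hl, hs⟩ := shortcut r (key _ _ hvy hyz)
            refine ⟨q', by simp only [Walk.length_cons]; omega, fun x hx => ?_⟩
            have := hs hx
            simp only [Walk.support_cons, List.mem_cons] at this ⊢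
            tauto
        · obtain ⟨q', hl, hs⟩ := shortcut r (key _ _ hu hby)
          refine ⟨q', by simp only [Walk.length_cons]; omega, fun x hx => ?_⟩
          have := hs hx
          simp only [Walk.support_cons, List.mem_cons] at this ⊢
          tauto
    · obtain ⟨q', hl, hs⟩ := ih ht ⟨d, hd, rfl, rfl⟩
      exact ⟨.cons hab q', by simpa using hl, List.cons_subset_cons _ hs⟩

/-- If `w` dominates every vertex at the end of a `2`-walk from `v`, then a walk between vertices
outside `Γ[v]` can avoid any given edge from `w` to `Γ[v]` without visiting new vertices. -/
theorem exists_walk_notMem_edges (G : SimpleGraph V) {v w u : V}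
    (key : ∀ a b, G.Adj v a → G.Adj a b → b = w ∨ G.Adj w b)
    (hu : u ∈ insert v (G.neighborSet v)) {s t : V} (hs : s ∉ insert v (G.neighborSet v))
    (ht : t ∉ insert v (G.neighborSet v)) (q : G.Walk s t) :
    ∃ q' : G.Walk s t, s(w, u) ∉ q'.edges ∧ q'.support ⊆ q.support := by
  induction hn : q.length using Nat.strong_induction_on generalizing q with
  | _ n ih =>
    by_cases he : s(w, u) ∈ q.edges
    · obtain ⟨q₁, hl, hsub⟩ :
          ∃ q' : G.Walk s t, q'.length < q.length ∧ q'.support ⊆ q.support := by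
        obtain ⟨d, hd, hde⟩ := List.mem_map.1 he
        rcases dart_edge_eq_mk'_iff'.1 hde with hwu | huw
        · exact exists_shorter_walk_of_mem_darts G key hu ht q ⟨d, hd, hwu⟩
        · obtain ⟨q', hl, hsub⟩ := exists_shorter_walk_of_mem_darts G key hu hs q.reverse
            ⟨d.symm, by simpa using hd, huw.2, huw.1⟩
          refine ⟨q'.reverse, by simpa using hl, fun x hx => ?_⟩
          simpa using hsub (by simpa using hx)
      obtain ⟨q₂, he₂, hsub₂⟩ := ih _ (hn ▸ hl) q₁ rfl
      exact ⟨q₂, he₂, List.Subset.trans hsub₂ hsub⟩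
    · exact ⟨q, he, List.Subset.refl _⟩

/-- If the closed neighbourhood `Γ[v]` contains neither terminal and
`A³(v,w) = Σ_{i ≠ w} A²(v,i)`, then every edge of `G` joining `w` to a vertex of
`Γ[v]` is dead. -/
theorem stmt17 [Fintype V] [DecidableEq V] (G : SimpleGraph V) [DecidableRel G.Adj]
    (t₁ t₂ : V) (hne : t₁ ≠ t₂) (v : V)
    (ht₁ : t₁ ∉ insert v (G.neighborSet v)) (ht₂ : t₂ ∉ insert v (G.neighborSet v))
    (w : V)
    (h : (G.adjMatrix ℕ ^ 3) v w = ∑ i ∈ Finset.univ.erase w, (G.adjMatrix ℕ ^ 2) v i) :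
    ∀ u ∈ insert v (G.neighborSet v), G.Adj w u → DeadEdge G t₁ t₂ s(w, u) := by
  intro u hu _ c
  have key : ∀ a b, G.Adj v a → G.Adj a b → b = w ∨ G.Adj w b :=
    fun _ _ => eq_or_adj_of_adjMatrix_pow_three_eq G h
  constructor
  · rintro ⟨p, hp⟩
    obtain ⟨q, he, hsub⟩ := exists_walk_notMem_edges G key hu ht₁ ht₂ p
    exact ⟨q.toDeleteEdge s(w, u) he, fun x hx => hp x (hsub (by simpa using hx))⟩
  · rintro ⟨p, hp⟩
    exact ⟨p.mapLe (G.deleteEdges_le _), fun x hx => hp x (by simpa using hx)⟩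
end

section
/- Let (G, t₁, t₂) be a Shannon position, let t be one of the terminals, and let u, v be two adjacent vertices that are both neighbours of t. Then the edge uv is dead. -/
open SimpleGraph

variable {V : Type*}

/-- If `P` holds at `t` and `t` is adjacent to both ends of the edge `uv`, then a walk staying
inside `P` can be rerouted through `t` so as to avoid `uv` while staying inside `P`. -/
theorem exists_walk_deleteEdges_of_adj_of_adj (G : SimpleGraph V) {t u v : V}
    (hu : G.Adj t u) (hv : G.Adj t v) (P : V → Prop) (ht : P t) {a b : V} (p : G.Walk a b)
    (hp : ∀ x ∈ p.support, P x) :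
    ∃ q : (G.deleteEdges {s(u, v)}).Walk a b, ∀ x ∈ q.support, P x := by
  have hu' : (G.deleteEdges {s(u, v)}).Adj t u := by
    have := hu.ne
    have := hv.ne
    simp_all [SimpleGraph.deleteEdges_adj]
  have hv' : (G.deleteEdges {s(u, v)}).Adj t v := by
    have := hu.ne
    have := hv.ne
    simp_all [SimpleGraph.deleteEdges_adj]
  induction p with
  | nil => exact ⟨Walk.nil, by simpa using hp⟩
  | @cons a c b h p ih =>
    obtain ⟨q, hq⟩ := ih fun x hx => hp x (by simp [hx])
    have ha : P a := hp a (by simp)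
    by_cases he : s(a, c) = s(u, v)
    · obtain ⟨h₁, h₂⟩ | ⟨h₁, h₂⟩ := Sym2.eq_iff.mp he
      · subst h₁ h₂
        exact ⟨Walk.cons hu'.symm (Walk.cons hv' q), by simp [ha, ht]; exact hq⟩
      · subst h₁ h₂
        exact ⟨Walk.cons hv'.symm (Walk.cons hu' q), by simp [ha, ht]; exact hq⟩
    · exact ⟨Walk.cons (by simpa only [SimpleGraph.deleteEdges_adj, Set.mem_singleton_iff]
        using ⟨h, he⟩) q, by simp [ha]; exact hq⟩

/-- An edge between two neighbours of a terminal is dead. -/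
theorem stmt18 [Fintype V] [DecidableEq V] (G : SimpleGraph V) (t₁ t₂ : V)
    (hne : t₁ ≠ t₂) (t : V) (ht : t = t₁ ∨ t = t₂) (u v : V)
    (hu : G.Adj t u) (hv : G.Adj t v) (huv : G.Adj u v) :
    DeadEdge G t₁ t₂ s(u, v) := by
  intro c
  constructor
  · rintro ⟨p, hp⟩
    refine exists_walk_deleteEdges_of_adj_of_adj G hu hv
      (fun x => x ≠ t₁ → x ≠ t₂ → c x = true) ?_ p hp
    intro h₁ h₂
    exact (ht.elim h₁ h₂).elim
  · rintro ⟨p, hp⟩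
    exact ⟨p.mapLe (G.deleteEdges_le _), by simpa using hp⟩
end

section
/- Let (G, t₁, t₂) be a Shannon position, let t be one of the terminals, and let U be a set of vertices with t₁ ∉ U and t₂ ∉ U such that t surrounds U, i.e. Γ(U) ⊆ Γ[t]. Then every vertex of U is dead. -/
open SimpleGraph

variable {V : Type*}

/-- If a vertex `t` surrounds `U`, every walk between vertices outside `U` that ends at `t` can be
shortcut to a walk avoiding `U`. -/
lemma SimpleGraph.Walk.exists_support_subset_disjoint {G : SimpleGraph V} {U : Set V} {x t : V}
    (p : G.Walk x t) (hsurr : nbhd G U ⊆ insert t (G.neighborSet t)) (ht : t ∉ U) (hx : x ∉ U) :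
    ∃ q : G.Walk x t, q.support ⊆ p.support ∧ ∀ y ∈ q.support, y ∉ U := by
  induction p with
  | nil => exact ⟨.nil, by simp, by simpa using hx⟩
  | @cons x y t h p ih =>
    by_cases hy : y ∈ U
    · rcases hsurr ⟨hx, y, hy, h.symm⟩ with rfl | hadj
      · exact ⟨.nil, by simp, by simpa using hx⟩
      · exact ⟨.cons (G.adj_symm hadj) .nil, by simp, by simp [hx, ht]⟩
    · obtain ⟨q, hqs, hqU⟩ := ih hsurr ht hy
      refine ⟨.cons h q, ?_, ?_⟩
      · exact List.cons_subset_cons _ hqs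
      · simpa [hx] using hqU

/-- Colours on a terminal-free set surrounded by a terminal do not affect whether Short wins. -/
lemma ShortWins.of_eqOn_compl {G : SimpleGraph V} {t₁ t₂ t : V} {U : Set V} {c c' : V → Bool}
    (h : ShortWins G t₁ t₂ c) (ht : t = t₁ ∨ t = t₂) (hU₁ : t₁ ∉ U) (hU₂ : t₂ ∉ U)
    (hsurr : nbhd G U ⊆ insert t (G.neighborSet t)) (hc : Set.EqOn c c' Uᶜ) :
    ShortWins G t₁ t₂ c' := by
  obtain ⟨p, hp⟩ := h
  obtain ⟨q, hqs, hqU⟩ :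
      ∃ q : G.Walk t₁ t₂, q.support ⊆ p.support ∧ ∀ y ∈ q.support, y ∉ U := by
    rcases ht with rfl | rfl
    · obtain ⟨q, hqs, hqU⟩ := p.reverse.exists_support_subset_disjoint hsurr hU₁ hU₂
      exact ⟨q.reverse, fun y hy ↦ by simpa using hqs (by simpa using hy), by simpa using hqU⟩
    · exact p.exists_support_subset_disjoint hsurr hU₂ hU₁
  exact ⟨q, fun x hx h₁ h₂ ↦ hc (hqU x hx) ▸ hp x (hqs hx) h₁ h₂⟩

/-- A terminal-free vertex set surrounded by a terminal is dead: every vertex of it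
is dead. -/
theorem stmt19 [Fintype V] [DecidableEq V] (G : SimpleGraph V) (t₁ t₂ : V)
    (hne : t₁ ≠ t₂) (t : V) (ht : t = t₁ ∨ t = t₂) (U : Set V)
    (hU₁ : t₁ ∉ U) (hU₂ : t₂ ∉ U)
    (hsurr : nbhd G U ⊆ insert t (G.neighborSet t)) :
    ∀ v ∈ U, DeadVertex G t₁ t₂ v := by
  intro v hv c
  have hc : Set.EqOn c (Function.update c v (! c v)) Uᶜ := fun x hx ↦
    (Function.update_of_ne (fun h : x = v ↦ hx (h ▸ hv)) _ _).symm
  exact ⟨fun h ↦ h.of_eqOn_compl ht hU₁ hU₂ hsurr hc,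
    fun h ↦ h.of_eqOn_compl ht hU₁ hU₂ hsurr hc.symm⟩
end
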